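/- (Quantitative combined lower bound) Let q be prime, k ≥ 2, and let L, M be natural numbers with L ≥ 1, L² < q, and k·(L+1)·(M+1)^(k−1) < q. Then the probability, over uniform g : Fin k → ZMod q, that Diam(q,k,g) > M is at least L^k/(2q + L^k). -/

import Mathlib

/-- `Diam q k g` is the least `N : ℕ` such that every `x : ZMod q` can be written as
`x = ∑ j, i j • g j` with `∑ j, i j ≤ N`, and `⊤` if no such `N` exists. -/
noncomputable def Diam (q k : ℕ) (g : Fin k → ZMod q) : ℕ∞ :=
  sInf ((↑) '' {N : ℕ | ∀ x : ZMod q, ∃ i : Fin k → ℕ,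
    (∑ j, i j) ≤ N ∧ x = ∑ j, (i j) • g j})

/-- Probability of the event `p` under the uniform measure on a finite type `α`. -/
noncomputable def Pr (α : Type*) (p : α → Prop) : ℝ :=
  (Nat.card {a // p a} : ℝ) / (Nat.card α : ℝ)

open Finset

/-- The natural vectors in `(0, L]^k` whose coordinates have greatest common divisor `1`. -/
def primitiveBox (k L : ℕ) : Finset (Fin k → ℕ) :=
  {a ∈ Fintype.piFinset fun _ : Fin k => Ioc 0 L | univ.gcd a = 1}

lemma sum_inv_odd_sq_le (n : ℕ) :
    ∑ m ∈ range n, 1 / (2 * (m : ℝ) + 3) ^ 2 ≤ 1 / 4 * (1 - 1 / ((n : ℝ) + 1)) := by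
  induction n with
  | zero => simp
  | succ n ih =>
    rw [sum_range_succ]
    have h : 1 / (2 * (n : ℝ) + 3) ^ 2 ≤ 1 / 4 * (1 / (n + 1) - 1 / (n + 2)) := by
      have : 1 / 4 * (1 / ((n : ℝ) + 1) - 1 / (n + 2)) = 1 / (4 * ((n + 1) * (n + 2))) := by
        field_simp
        ring
      rw [this]
      apply one_div_le_one_div_of_le (by positivity)
      nlinarith
    push_cast
    rw [add_assoc (n : ℝ) 1 1, one_add_one_eq_two]
    linarith

lemma sum_inv_prime_sq_le (n : ℕ) :
    ∑ p ∈ range (n + 1) with p.Prime, 1 / (p : ℝ) ^ 2 ≤ 1 / 2 := by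
  have hsub : {p ∈ range (n + 1) | p.Prime} ⊆
      insert 2 ((range n).image fun m => 2 * m + 3) := by
    intro p hp
    simp only [mem_filter, mem_range, mem_insert, mem_image] at hp ⊢
    rcases hp.2.eq_two_or_odd with h | h
    · exact Or.inl h
    · have := hp.2.two_le
      exact Or.inr ⟨(p - 3) / 2, by omega, by omega⟩
  refine (sum_le_sum_of_subset_of_nonneg hsub fun _ _ _ => by positivity).trans ?_
  rw [sum_insert (by simp only [mem_image, not_exists, not_and]; omega),
    sum_image (fun x _ y _ h => by simpa using h)]
  have h := sum_inv_odd_sq_le n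
  have h' : (0 : ℝ) ≤ 1 / ((n : ℝ) + 1) := by positivity
  push_cast
  linarith

lemma pow_le_two_mul_card_primitiveBox {k : ℕ} (hk : 2 ≤ k) (L : ℕ) :
    L ^ k ≤ 2 * #(primitiveBox k L) := by
  set box := Fintype.piFinset fun _ : Fin k => Ioc 0 L with hbox
  have hcard : #box = L ^ k := by simp [hbox]
  have hsplit : #(primitiveBox k L) + #{a ∈ box | ¬ univ.gcd a = 1} = #box :=
    card_filter_add_card_filter_not _
  have hsub : {a ∈ box | ¬ univ.gcd a = 1} ⊆ {p ∈ range (L + 1) | p.Prime}.biUnion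
      fun p => Fintype.piFinset fun _ : Fin k => {x ∈ Ioc 0 L | p ∣ x} := by
    intro a ha
    simp only [hbox, mem_filter, Fintype.mem_piFinset, mem_Ioc] at ha
    obtain ⟨p, hp, hdvd⟩ := Nat.exists_prime_and_dvd ha.2
    have hpa : ∀ j, p ∣ a j := fun j => hdvd.trans (gcd_dvd (mem_univ j))
    simp only [mem_biUnion, mem_filter, mem_range, Fintype.mem_piFinset, mem_Ioc]
    have h0 := ha.1 ⟨0, by omega⟩
    have := Nat.le_of_dvd h0.1 (hpa _)
    exact ⟨p, ⟨by omega, hp⟩, fun j => ⟨ha.1 j, hpa j⟩⟩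
  have hbad : #{a ∈ box | ¬ univ.gcd a = 1} ≤
      ∑ p ∈ range (L + 1) with p.Prime, (L / p) ^ k := by
    refine (card_le_card hsub).trans (card_biUnion_le.trans (sum_le_sum fun p _ => ?_))
    simp [Nat.Ioc_filter_dvd_card_eq_div]
  have hreal : ((∑ p ∈ range (L + 1) with p.Prime, (L / p) ^ k : ℕ) : ℝ) ≤ L ^ k * (1 / 2) := by
    refine le_trans ?_ (mul_le_mul_of_nonneg_left (sum_inv_prime_sq_le L) (by positivity))
    rw [mul_sum]
    push_cast
    refine sum_le_sum fun p hp => ?_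
    have hp1 : (1 : ℝ) ≤ p := by exact_mod_cast (mem_filter.1 hp).2.one_le
    calc ((L / p : ℕ) : ℝ) ^ k ≤ ((L : ℝ) / p) ^ k := by
          gcongr
          exact Nat.cast_div_le
      _ = L ^ k * (1 / p ^ k) := by ring
      _ ≤ L ^ k * (1 / p ^ 2) := by gcongr
  have hbad' : (#{a ∈ box | ¬ univ.gcd a = 1} : ℝ) ≤ L ^ k * (1 / 2) :=
    le_trans (by exact_mod_cast hbad) hreal
  have hsplit' : (#(primitiveBox k L) : ℝ) + #{a ∈ box | ¬ univ.gcd a = 1} = L ^ k := by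
    exact_mod_cast hsplit.trans hcard
  have : (L : ℝ) ^ k ≤ 2 * #(primitiveBox k L) := by linarith
  exact_mod_cast this

lemma eq_of_mem_primitiveBox_of_cross_mul_eq {k L : ℕ} {a b : Fin k → ℕ}
    (ha : a ∈ primitiveBox k L) (hb : b ∈ primitiveBox k L)
    (h : ∀ i j, a i * b j = b i * a j) : a = b := by
  funext i
  have hab : univ.gcd (fun j => a i * b j) = univ.gcd fun j => b i * a j := by simp only [h]
  rw [Finset.gcd_mul_left, Finset.gcd_mul_left] at hab
  simpa [(mem_filter.1 ha).2, (mem_filter.1 hb).2] using hab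

/-- A surjective additive homomorphism of finite groups has all fibres of the same size. -/
lemma card_zero_fiber_mul_card {G H : Type*} [AddCommGroup G] [AddCommGroup H] [Fintype G]
    [Fintype H] [DecidableEq H] (f : G →+ H) (hf : Function.Surjective f) :
    #{g | f g = 0} * Fintype.card H = Fintype.card G := by
  have h := card_eq_sum_card_fiberwise (f := f) (s := (univ : Finset G)) (t := univ)
    (fun _ _ => by simp)
  rw [sum_congr rfl fun y _ => AddMonoidHom.card_fiber_eq_of_mem_range f (hf y) (hf 0)] at h
  rw [sum_const, card_univ, card_univ, smul_eq_mul] at h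
  rw [h, mul_comm]

/-- The additive homomorphism `g ↦ ∑ j, a j • g j`. -/
def combHom (q : ℕ) {k : ℕ} (a : Fin k → ℕ) : (Fin k → ZMod q) →+ ZMod q where
  toFun g := ∑ j, a j • g j
  map_zero' := by simp
  map_add' g h := by simp [smul_add, sum_add_distrib]

lemma combHom_apply {q k : ℕ} (a : Fin k → ℕ) (g : Fin k → ZMod q) :
    combHom q a g = ∑ j, a j • g j := rfl

lemma combHom_single {q k : ℕ} (a : Fin k → ℕ) (i : Fin k) (x : ZMod q) :
    combHom q a (Pi.single i x) = a i * x := by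
  rw [combHom_apply, sum_eq_single i] <;> simp +contextual [Pi.single_eq_of_ne]

section PrimeModulus

variable {q k : ℕ} [Fact q.Prime]

lemma combHom_surjective {a : Fin k → ℕ} {i : Fin k} (ha : (a i : ZMod q) ≠ 0) :
    Function.Surjective (combHom q a) := fun x =>
  ⟨Pi.single i ((a i : ZMod q)⁻¹ * x), by rw [combHom_single]; field_simp⟩

lemma combHom_prod_surjective {a b : Fin k → ℕ} {i j : Fin k}
    (hab : (a i * b j : ZMod q) ≠ b i * a j) :
    Function.Surjective ((combHom q a).prod (combHom q b)) := by
  rintro ⟨x, y⟩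
  have hd : (a i * b j - b i * a j : ZMod q) ≠ 0 := sub_ne_zero.2 hab
  refine ⟨Pi.single i ((b j * x - a j * y) / (a i * b j - b i * a j)) +
    Pi.single j ((a i * y - b i * x) / (a i * b j - b i * a j)), ?_⟩
  rw [AddMonoidHom.prod_apply, map_add, map_add]
  simp only [combHom_single]
  ext
  · change a i * _ + a j * _ = x
    rw [mul_div_assoc', mul_div_assoc', ← add_div, div_eq_iff hd]
    ring
  · change b i * _ + b j * _ = y
    rw [mul_div_assoc', mul_div_assoc', ← add_div, div_eq_iff hd]
    ring

lemma card_combHom_eq_zero {L : ℕ} (hk : 2 ≤ k) (hLq : L ^ 2 < q) {a : Fin k → ℕ}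
    (ha : a ∈ primitiveBox k L) :
    #{g : Fin k → ZMod q | combHom q a g = 0} * q = q ^ k := by
  have h0 := mem_Ioc.1 (Fintype.mem_piFinset.1 (mem_filter.1 ha).1 ⟨0, by omega⟩)
  have hne : (a ⟨0, by omega⟩ : ZMod q) ≠ 0 := by
    rw [Ne, ZMod.natCast_eq_zero_iff]
    intro h
    have := Nat.le_of_dvd h0.1 h
    nlinarith
  have h := card_zero_fiber_mul_card _ (combHom_surjective hne)
  simpa [ZMod.card] using h

lemma card_combHom_eq_zero_and {L : ℕ} (hLq : L ^ 2 < q) {a b : Fin k → ℕ}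
    (ha : a ∈ primitiveBox k L) (hb : b ∈ primitiveBox k L) (hab : a ≠ b) :
    #{g : Fin k → ZMod q | combHom q a g = 0 ∧ combHom q b g = 0} * q ^ 2 = q ^ k := by
  obtain ⟨i, j, hij⟩ : ∃ i j, (a i * b j : ZMod q) ≠ b i * a j := by
    by_contra! h
    refine hab (eq_of_mem_primitiveBox_of_cross_mul_eq ha hb fun i j => ?_)
    have ha' := fun i => (mem_Ioc.1 (Fintype.mem_piFinset.1 (mem_filter.1 ha).1 i)).2
    have hb' := fun i => (mem_Ioc.1 (Fintype.mem_piFinset.1 (mem_filter.1 hb).1 i)).2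
    have hmod : a i * b j ≡ b i * a j [MOD q] := by
      rw [← ZMod.natCast_eq_natCast_iff]
      exact_mod_cast h i j
    have h1 := Nat.mul_le_mul (ha' i) (hb' j)
    have h2 := Nat.mul_le_mul (hb' i) (ha' j)
    exact hmod.eq_of_lt_of_lt (by nlinarith) (by nlinarith)
  have h := card_zero_fiber_mul_card _ (combHom_prod_surjective hij)
  simpa [ZMod.card, sq, Prod.ext_iff] using h

/-- Second moment bound for the number of `g` annihilated by some primitive vector. -/
lemma card_primitiveBox_mul_le {L : ℕ} (hk : 2 ≤ k) (hLq : L ^ 2 < q) :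
    (#(primitiveBox k L) : ℝ) * q ^ k ≤
      #{g : Fin k → ZMod q | ∃ a ∈ primitiveBox k L, combHom q a g = 0} *
        (q + #(primitiveBox k L)) := by
  set A := primitiveBox k L
  set B : Finset (Fin k → ZMod q) := {g | ∃ a ∈ A, combHom q a g = 0} with hB
  have hq0 : (0 : ℝ) < q := by exact_mod_cast (Fact.out : q.Prime).pos
  rcases A.eq_empty_or_nonempty with hA | hA
  · simp [hA]
    positivity
  have hn0 : (0 : ℝ) < #A := by exact_mod_cast hA.card_pos
  let N : (Fin k → ZMod q) → ℝ := fun g => ∑ a ∈ A, if combHom q a g = 0 then 1 else 0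
  have hfirst : ∑ g, N g = #A * (q ^ k / q) := by
    rw [sum_comm, ← nsmul_eq_mul]
    refine sum_eq_card_nsmul fun a ha => ?_
    rw [sum_boole, eq_div_iff hq0.ne']
    exact_mod_cast card_combHom_eq_zero hk hLq ha
  have hN0 : ∀ g ∉ B, N g = 0 := by
    intro g hg
    refine sum_eq_zero fun a ha => if_neg fun h => hg ?_
    exact mem_filter.2 ⟨mem_univ _, a, ha, h⟩
  have hfirst' : ∑ g ∈ B, N g = #A * (q ^ k / q) := by
    rw [← hfirst]
    exact sum_subset (subset_univ _) fun g _ hg => hN0 g hg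
  have hpair : ∀ a ∈ A, ∀ b ∈ A, (∑ g : Fin k → ZMod q,
      (if combHom q a g = 0 then (1 : ℝ) else 0) * (if combHom q b g = 0 then 1 else 0)) ≤
      (if a = b then (q : ℝ) ^ k / q else 0) + q ^ k / q ^ 2 := by
    intro a ha b hb
    simp only [ite_zero_mul_ite_zero, mul_one]
    rw [sum_boole]
    split_ifs with hab
    · subst hab
      simp only [and_self]
      have h : (#{g : Fin k → ZMod q | combHom q a g = 0} : ℝ) = q ^ k / q := by
        rw [eq_div_iff hq0.ne']
        exact_mod_cast card_combHom_eq_zero hk hLq ha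
      rw [h]
      exact le_add_of_nonneg_right (by positivity)
    · rw [zero_add]
      apply le_of_eq
      rw [eq_div_iff (by positivity)]
      exact_mod_cast card_combHom_eq_zero_and hLq ha hb hab
  have hsecond : ∑ g ∈ B, N g ^ 2 ≤ #A * (q ^ k / q) + #A ^ 2 * (q ^ k / q ^ 2) := by
    calc ∑ g ∈ B, N g ^ 2 ≤ ∑ g, N g ^ 2 :=
          sum_le_sum_of_subset_of_nonneg (subset_univ _) fun _ _ _ => sq_nonneg _
      _ = ∑ a ∈ A, ∑ b ∈ A, ∑ g : Fin k → ZMod q, (if combHom q a g = 0 then (1 : ℝ) else 0) *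
            (if combHom q b g = 0 then 1 else 0) := by
          simp only [N, sq, sum_mul_sum]
          rw [sum_comm]
          exact sum_congr rfl fun a _ => sum_comm
      _ ≤ ∑ a ∈ A, ∑ b ∈ A, ((if a = b then (q : ℝ) ^ k / q else 0) + q ^ k / q ^ 2) :=
          sum_le_sum fun a ha => sum_le_sum fun b hb => hpair a ha b hb
      _ = #A * (q ^ k / q) + #A ^ 2 * (q ^ k / q ^ 2) := by
          simp only [sum_add_distrib, sum_ite_eq, sum_const, nsmul_eq_mul]
          rw [sum_congr rfl fun a ha => if_pos ha, sum_const, nsmul_eq_mul]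
          ring
  have hCS := sq_sum_le_card_mul_sum_sq (s := B) (f := N)
  rw [hfirst'] at hCS
  have h := hCS.trans (mul_le_mul_of_nonneg_left hsecond (by positivity))
  have hpos : (0 : ℝ) < #A * q ^ k / q ^ 2 := by positivity
  refine le_of_mul_le_mul_left ?_ hpos
  calc (#A * q ^ k / q ^ 2 : ℝ) * (#A * q ^ k) = (#A * (q ^ k / q)) ^ 2 := by
        field_simp
    _ ≤ _ := h
    _ = _ := by field_simp

end PrimeModulus

/-- Subtracting a relation with positive coefficients repeatedly makes some coordinate small. -/
lemma exists_reduced_representation {q k : ℕ} [NeZero k] {a : Fin k → ℕ} {g : Fin k → ZMod q}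
    (hpos : ∀ j, 0 < a j) (hag : combHom q a g = 0) (i : Fin k → ℕ) :
    ∃ i' : Fin k → ℕ, (∀ j, i' j ≤ i j) ∧ combHom q i' g = combHom q i g ∧
      ∃ j, i' j < a j := by
  induction hn : i 0 using Nat.strong_induction_on generalizing i with
  | _ n ih =>
    by_cases h : ∃ j, i j < a j
    · exact ⟨i, fun _ => le_rfl, rfl, h⟩
    · push Not at h
      have hlt : i 0 - a 0 < n := by have := h 0; have := hpos 0; omega
      obtain ⟨i', hle, heq, hj⟩ := ih _ hlt (fun j => i j - a j) rfl
      refine ⟨i', fun j => (hle j).trans (Nat.sub_le _ _), heq.trans ?_, hj⟩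
      have hsum : combHom q (fun j => i j - a j) g + combHom q a g = combHom q i g := by
        simp only [combHom_apply, ← sum_add_distrib, ← add_smul]
        exact sum_congr rfl fun j _ => by rw [Nat.sub_add_cancel (h j)]
      rw [← hsum, hag, add_zero]

lemma lt_diam_of_relation {q k L M : ℕ} [NeZero q] [NeZero k] {a : Fin k → ℕ}
    {g : Fin k → ZMod q} (hpos : ∀ j, 0 < a j) (hle : ∀ j, a j ≤ L) (hag : combHom q a g = 0)
    (hM : k * L * (M + 1) ^ (k - 1) < q) : (M : ℕ∞) < Diam q k g := by
  rw [← ENat.add_one_le_iff (ENat.natCast_ne_top M)]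
  refine le_sInf ?_
  rintro _ ⟨N, hN, rfl⟩
  by_contra! hlt
  have hNM : N ≤ M := by
    have : N < M + 1 := by exact_mod_cast hlt
    omega
  let S : Finset (Fin k → ℕ) := univ.biUnion fun j : Fin k =>
    Fintype.piFinset (Function.update (fun _ => range (M + 1)) j (range L))
  have hS : #S ≤ k * (L * (M + 1) ^ (k - 1)) := by
    refine card_biUnion_le.trans (le_of_eq ?_)
    rw [sum_eq_card_nsmul (b := L * (M + 1) ^ (k - 1)), card_univ, Fintype.card_fin, smul_eq_mul]
    intro j _
    rw [Fintype.card_piFinset, ← mul_prod_erase univ _ (mem_univ j),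
      Function.update_self, card_range,
      prod_eq_pow_card (b := M + 1) fun l hl => by simp [(mem_erase.1 hl).1]]
    simp
  have hcover : (univ : Finset (ZMod q)) ⊆ S.image fun i => combHom q i g := by
    intro x _
    obtain ⟨i, hi, hx⟩ := hN x
    obtain ⟨i', hi', heq, j, hj⟩ := exists_reduced_representation hpos hag i
    refine mem_image.2 ⟨i', mem_biUnion.2 ⟨j, mem_univ j, ?_⟩, heq.trans hx.symm⟩
    rw [Fintype.mem_piFinset]
    intro l
    rcases eq_or_ne l j with rfl | hl
    · simpa using hj.trans_le (hle l)
    · have := single_le_sum (f := i) (fun _ _ => Nat.zero_le _) (mem_univ l)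
      have := hi' l
      simp only [Function.update_of_ne hl, mem_range]
      omega
  have hcard := (card_le_card hcover).trans (card_image_le.trans hS)
  rw [card_univ, ZMod.card, ← mul_assoc] at hcard
  omega

/-- (Quantitative combined lower bound) For `q` prime, `k ≥ 2`, `L ≥ 1` with `L² < q` and
`k(L+1)(M+1)^(k-1) < q`, the probability over uniform `g : Fin k → ZMod q` that
`Diam(q,k,g) > M` is at least `L^k/(2q + L^k)`. -/
theorem diam_lower_bound_quantitative (q k : ℕ) (hq : Nat.Prime q) (hk : 2 ≤ k)
    (L M : ℕ) (hL : 1 ≤ L) (hLq : L ^ 2 < q)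
    (hM : k * (L + 1) * (M + 1) ^ (k - 1) < q) :
    (L : ℝ) ^ k / (2 * (q : ℝ) + (L : ℝ) ^ k)
      ≤ Pr (Fin k → ZMod q) (fun g => (M : ℕ∞) < Diam q k g) := by
  classical
  have : Fact q.Prime := ⟨hq⟩
  have : NeZero k := ⟨by omega⟩
  have hq0 : (0 : ℝ) < q := by exact_mod_cast hq.pos
  have hM' : k * L * (M + 1) ^ (k - 1) < q := lt_of_le_of_lt (by gcongr; omega) hM
  set B : Finset (Fin k → ZMod q) := {g | ∃ a ∈ primitiveBox k L, combHom q a g = 0}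
  have hsub : B ⊆ univ.filter fun g : Fin k → ZMod q => (M : ℕ∞) < Diam q k g := by
    intro g hg
    obtain ⟨a, ha, hag⟩ := (mem_filter.1 hg).2
    have hbox := fun j => mem_Ioc.1 (Fintype.mem_piFinset.1 (mem_filter.1 ha).1 j)
    exact mem_filter.2 ⟨mem_univ g,
      lt_diam_of_relation (fun j => (hbox j).1) (fun j => (hbox j).2) hag hM'⟩
  have hPr : (#B : ℝ) / q ^ k ≤ Pr (Fin k → ZMod q) (fun g => (M : ℕ∞) < Diam q k g) := by
    have hden : (Nat.card (Fin k → ZMod q) : ℝ) = q ^ k := by simp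
    rw [Pr, hden, Nat.card_eq_fintype_card, Fintype.card_subtype]
    gcongr
  refine le_trans ?_ hPr
  have hmom : (#(primitiveBox k L) : ℝ) * q ^ k ≤ #B * (q + #(primitiveBox k L)) :=
    card_primitiveBox_mul_le hk hLq
  have hdens : (L : ℝ) ^ k ≤ 2 * #(primitiveBox k L) := by
    exact_mod_cast pow_le_two_mul_card_primitiveBox hk L
  have hL0 : (0 : ℝ) < (L : ℝ) ^ k := by
    have : (0 : ℝ) < L := by exact_mod_cast hL
    positivity
  calc (L : ℝ) ^ k / (2 * q + L ^ k)
      ≤ #(primitiveBox k L) / (q + #(primitiveBox k L)) := by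
        rw [div_le_div_iff₀ (by positivity) (by positivity)]
        nlinarith
    _ ≤ #B / q ^ k := by
        rw [div_le_div_iff₀ (by positivity) (by positivity)]
        exact hmom
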